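/- Let (G, H, Φ, 𝓑) be a relative Rota-Baxter group. Define Φ̄(g)(𝓑(h), h) = (𝓑(Φ(g)h), Φ(g)h) and Θ̄(𝓑(h), h)g = 𝓑(Φ(g)h)⁻¹ · g · 𝓑(h). Then Φ̄ is a left action of G on the graph subgroup Gr(𝓑), Θ̄ is a right action of Gr(𝓑) on G, and together they satisfy the matched pair conditions: Φ̄(g)(ξ₁ξ₂) = Φ̄(g)ξ₁ · Φ̄(Θ̄(ξ₁)g)ξ₂ and Θ̄(ξ)(g₁g₂) = Θ̄(Φ̄(g₂)ξ)g₁ · Θ̄(ξ)g₂ for all g, g₁, g₂ ∈ G and ξ, ξ₁, ξ₂ ∈ Gr(𝓑). -/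

import Mathlib

/-- For a relative Rota-Baxter group `(G, H, Φ, 𝓑)`, the operations
`Φ̄(g)(𝓑 h, h) = (𝓑(Φ(g)h), Φ(g)h)` and `Θ̄(𝓑 h, h)g = 𝓑(Φ(g)h)⁻¹ · g · 𝓑(h)`
form a matched pair of the groups `G` and `Gr(𝓑)`.  We identify `Gr(𝓑)` with
`H` via `h ↦ (𝓑 h, h)`; the graph group product becomes
`p h₁ h₂ = h₁ · Φ(𝓑 h₁)h₂`, the left action `Φ̄` of `G` becomes `Φ` itself,
and `Θ̄ h g = 𝓑(Φ(g)h)⁻¹ · g · 𝓑(h)`.  The conclusions state that `Φ̄` is a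
left action, `Θ̄` is a right action, and the two matched-pair compatibility
conditions hold. -/
theorem relative_rota_baxter_group_matched_pair
    {G H : Type*} [Group G] [Group H] (Φ : G →* MulAut H) (𝓑 : H → G)
    (h𝓑 : ∀ a b : H, 𝓑 a * 𝓑 b = 𝓑 (a * Φ (𝓑 a) b))
    (p : H → H → H) (hp : ∀ a b : H, p a b = a * Φ (𝓑 a) b)
    (Θ : H → G → G) (hΘ : ∀ (h : H) (g : G), Θ h g = (𝓑 (Φ g h))⁻¹ * g * 𝓑 h) :
    -- Φ̄ is a left action of G on Gr(𝓑)
    (∀ h : H, Φ (1 : G) h = h) ∧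
    (∀ (g₁ g₂ : G) (h : H), Φ (g₁ * g₂) h = Φ g₁ (Φ g₂ h)) ∧
    -- Θ̄ is a right action of Gr(𝓑) on G
    (∀ g : G, Θ (1 : H) g = g) ∧
    (∀ (g : G) (h₁ h₂ : H), Θ (p h₁ h₂) g = Θ h₂ (Θ h₁ g)) ∧
    -- the matched-pair compatibility conditions
    (∀ (g : G) (h₁ h₂ : H), Φ g (p h₁ h₂) = p (Φ g h₁) (Φ (Θ h₁ g) h₂)) ∧
    (∀ (g₁ g₂ : G) (h : H), Θ h (g₁ * g₂) = Θ (Φ g₂ h) g₁ * Θ h g₂) := by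
  have h1 : 𝓑 1 = 1 := by
    have h := h𝓑 1 1
    rw [map_one, mul_one] at h
    exact mul_eq_left.mp h
  have hBp : ∀ a b : H, 𝓑 (p a b) = 𝓑 a * 𝓑 b := fun a b => by rw [hp, h𝓑]
  have hmul : ∀ (g₁ g₂ : G) (h : H), Φ (g₁ * g₂) h = Φ g₁ (Φ g₂ h) := fun g₁ g₂ h => by
    rw [map_mul, MulAut.mul_apply]
  have hc : ∀ (g : G) (h₁ h₂ : H), Φ g (p h₁ h₂) = p (Φ g h₁) (Φ (Θ h₁ g) h₂) := by
    intro g h₁ h₂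
    have e : 𝓑 (Φ g h₁) * Θ h₁ g = g * 𝓑 h₁ := by rw [hΘ]; group
    rw [hp, hp, map_mul, ← hmul, ← hmul, e]
  refine ⟨fun h => by rw [map_one, MulAut.one_apply], hmul, fun g => ?_, ?_, hc, ?_⟩
  · rw [hΘ, map_one, h1]; group
  · intro g h₁ h₂
    rw [hΘ (p h₁ h₂), hc, hBp, hBp, hΘ h₂ (Θ h₁ g)]
    generalize 𝓑 (Φ (Θ h₁ g) h₂) = x
    rw [hΘ]
    group
  · intro g₁ g₂ h
    rw [hΘ, hΘ, hΘ, hmul]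
    group
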